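/- Upward closure of the bounding relation under maximum (Lemma 1): if t ξ ⊑_τ χ, then for all complexities χ' ∈ ⟦⟦τ⟧⟧, t ξ ⊑_τ χ ∨ χ', where ∨ is the componentwise (and at function potential types, pointwise) maximum on complexities. -/

import Mathlib

/-! Formalization of Lemma 1 (upward closure of the bounding relation under
maximum) of "A static cost analysis for a higher-order language"
(Danner–Paykin–Royer). -/

/-! ### Target language: syntax, free variables, typing -/

/-- Target-language types: `int`, `bool`, `int*` (integer lists), and arrow types. -/
inductive Ty where
  | int : Ty
  | bool : Ty
  | list : Ty
  | arrow : Ty → Ty → Ty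
deriving DecidableEq

/-- Target-language expressions (named variables). `rel` covers binary numeric
relations (≤, <, =, …) and `op` covers binary numeric operations (+, ×, …). -/
inductive Exp where
  | var (x : String)
  | intConst (n : ℤ)
  | boolConst (b : Bool)
  | nil
  | cons (r s : Exp)
  | rel (R : ℤ → ℤ → Bool) (r s : Exp)
  | op (f : ℤ → ℤ → ℤ) (r s : Exp)
  | ite (r s t : Exp)
  | lam (x : String) (r : Exp)
  | app (r s : Exp)
  | case (r s : Exp) (x xs : String) (t : Exp)
  | fold (r s : Exp) (x xs w : String) (t : Exp)

/-- Free variables of a target expression. -/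
def Exp.fv : Exp → List String
  | .var x => [x]
  | .intConst _ => []
  | .boolConst _ => []
  | .nil => []
  | .cons r s => r.fv ++ s.fv
  | .rel _ r s => r.fv ++ s.fv
  | .op _ r s => r.fv ++ s.fv
  | .ite r s t => r.fv ++ s.fv ++ t.fv
  | .lam x r => r.fv.removeAll [x]
  | .app r s => r.fv ++ s.fv
  | .case r s x xs t => r.fv ++ s.fv ++ t.fv.removeAll [x, xs]
  | .fold r s x xs w t => r.fv ++ s.fv ++ t.fv.removeAll [x, xs, w]

/-- Target-language typing contexts. -/
def TCtx : Type := String → Option Ty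

/-- Context update `Γ, x : τ`. -/
def TCtx.update (Γ : TCtx) (x : String) (τ : Ty) : TCtx :=
  fun y => if y = x then some τ else Γ y

/-- Target-language typing judgment `Γ ⊢ e : τ`. -/
inductive HasTy : TCtx → Exp → Ty → Prop where
  | var {Γ x τ} : Γ x = some τ → HasTy Γ (.var x) τ
  | intConst {Γ n} : HasTy Γ (.intConst n) .int
  | boolConst {Γ b} : HasTy Γ (.boolConst b) .bool
  | nil {Γ} : HasTy Γ .nil .list
  | cons {Γ r s} : HasTy Γ r .int → HasTy Γ s .list → HasTy Γ (.cons r s) .list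
  | rel {Γ R r s} : HasTy Γ r .int → HasTy Γ s .int → HasTy Γ (.rel R r s) .bool
  | op {Γ f r s} : HasTy Γ r .int → HasTy Γ s .int → HasTy Γ (.op f r s) .int
  | ite {Γ r s t τ} : HasTy Γ r .bool → HasTy Γ s τ → HasTy Γ t τ →
      HasTy Γ (.ite r s t) τ
  | lam {Γ x r σ τ} : HasTy (Γ.update x σ) r τ → HasTy Γ (.lam x r) (.arrow σ τ)
  | app {Γ r s σ τ} : HasTy Γ r (.arrow σ τ) → HasTy Γ s σ → HasTy Γ (.app r s) τ
  | case {Γ r s x xs t σ} : HasTy Γ r .list → HasTy Γ s σ →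
      HasTy ((Γ.update x .int).update xs .list) t σ →
      HasTy Γ (.case r s x xs t) σ
  | fold {Γ r s x xs w t σ} : HasTy Γ r .list → HasTy Γ s σ →
      HasTy (((Γ.update x .int).update xs .list).update w σ) t σ →
      HasTy Γ (.fold r s x xs w t) σ
/-! ### Target language: values, environments, big-step evaluation with cost -/

/-- Target-language values: booleans, integers, integer sequences, and closures. -/
inductive Val where
  | vbool (b : Bool)
  | vint (n : ℤ)
  | vlist (ns : List ℤ)
  | vclos (x : String) (r : Exp) (θ : String → Option Val)

/-- Value environments. -/
def VEnv : Type := String → Option Val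

/-- Environment update `ξ[x ↦ v]`. -/
def VEnv.update (ξ : VEnv) (x : String) (v : Val) : VEnv :=
  fun y => if y = x then some v else ξ y

/-- Big-step call-by-value evaluation `t ξ ↓ v` together with the size of the
evaluation derivation (every inference rule counts, and the arithmetic side
condition of relation/operation rules has unit cost).  `Eval t ξ v n` means
that the closure `t ξ` evaluates to the value `v` with a derivation of size
(cost) `n`.  In the `fold` rule on a nonempty list `(n, ns)`, a fresh variable
`y` is bound to `ns` for the recursive call. -/
inductive Eval : Exp → VEnv → Val → ℕ → Prop where
  | var {ξ x v} : ξ x = some v → Eval (.var x) ξ v 1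
  | intConst {ξ n} : Eval (.intConst n) ξ (.vint n) 1
  | boolConst {ξ b} : Eval (.boolConst b) ξ (.vbool b) 1
  | lam {ξ x r} : Eval (.lam x r) ξ (.vclos x r ξ) 1
  | nil {ξ} : Eval .nil ξ (.vlist []) 1
  | rel {ξ R r s m n a b} : Eval r ξ (.vint m) a → Eval s ξ (.vint n) b →
      Eval (.rel R r s) ξ (.vbool (R m n)) (2 + a + b)
  | op {ξ f r s m n a b} : Eval r ξ (.vint m) a → Eval s ξ (.vint n) b →
      Eval (.op f r s) ξ (.vint (f m n)) (2 + a + b)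
  | cons {ξ r s m ns a b} : Eval r ξ (.vint m) a → Eval s ξ (.vlist ns) b →
      Eval (.cons r s) ξ (.vlist (m :: ns)) (1 + a + b)
  | iteTrue {ξ r s t v a b} : Eval r ξ (.vbool true) a → Eval s ξ v b →
      Eval (.ite r s t) ξ v (1 + a + b)
  | iteFalse {ξ r s t v a b} : Eval r ξ (.vbool false) a → Eval t ξ v b →
      Eval (.ite r s t) ξ v (1 + a + b)
  | app {ξ r s x r' θ v₁ v a b c} : Eval r ξ (.vclos x r' θ) a → Eval s ξ v₁ b →
      Eval r' (VEnv.update θ x v₁) v c → Eval (.app r s) ξ v (1 + a + b + c)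
  | caseNil {ξ r s x xs t v a b} : Eval r ξ (.vlist []) a → Eval s ξ v b →
      Eval (.case r s x xs t) ξ v (1 + a + b)
  | caseCons {ξ r s x xs t n ns v a b} : Eval r ξ (.vlist (n :: ns)) a →
      Eval t ((ξ.update x (.vint n)).update xs (.vlist ns)) v b →
      Eval (.case r s x xs t) ξ v (1 + a + b)
  | foldNil {ξ r s x xs w t v a b} : Eval r ξ (.vlist []) a → Eval s ξ v b →
      Eval (.fold r s x xs w t) ξ v (1 + a + b)
  | foldCons {ξ r s x xs w t y n ns v₀ v a b c} :
      y ∉ (Exp.fold r s x xs w t).fv →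
      Eval r ξ (.vlist (n :: ns)) a →
      Eval (.fold (.var y) s x xs w t) (ξ.update y (.vlist ns)) v₀ b →
      Eval t (((ξ.update x (.vint n)).update xs (.vlist ns)).update w v₀) v c →
      Eval (.fold r s x xs w t) ξ v (1 + a + b + c)
/-! ### Complexity denotations and the bounding relations -/

/-- The denotation of the potential type of the translation of a target type:
base types have potential ℕ (a size), and the potential of a function maps
argument potentials to complexities of results. -/
def potDen : Ty → Type
  | .int => ℕ
  | .bool => ℕ
  | .list => ℕ
  | .arrow σ τ => potDen σ → ℕ × potDen τ

/-- The value bounding relation `v θ ⊑ᵛ_σ p` between values and potentials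
(environments of base-type values are irrelevant and closures carry their own
environment). -/
def BVal : (σ : Ty) → Val → potDen σ → Prop
  | .bool, .vbool _, p => Nat.le 1 p
  | .int, .vint _, p => Nat.le 1 p
  | .list, .vlist ns, p => Nat.le ns.length p
  | .arrow σ τ, .vclos x r θ, f =>
      ∀ (z : Val) (q : potDen σ), BVal σ z q →
        ∀ (v : Val) (n : ℕ), Eval r (VEnv.update θ x z) v n →
          n ≤ Prod.fst (f q) ∧ BVal τ v (Prod.snd (f q))
  | _, _, _ => False

/-- The bounding relation `t ξ ⊑_σ χ` between closures and complexities: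
whenever `t ξ ↓ v θ`, the cost of `t ξ` is at most `cost χ` and
`v θ ⊑ᵛ_σ pot χ`. -/
def BClos (σ : Ty) (t : Exp) (ξ : VEnv) (χ : ℕ × potDen σ) : Prop :=
  ∀ (v : Val) (n : ℕ), Eval t ξ v n → n ≤ χ.1 ∧ BVal σ v χ.2

/-- Pointwise/componentwise maximum of two potentials. -/
def potMax : (σ : Ty) → potDen σ → potDen σ → potDen σ
  | .int, p, q => Nat.max p q
  | .bool, p, q => Nat.max p q
  | .list, p, q => Nat.max p q
  | .arrow _ τ, f, g => fun z =>
      (max (Prod.fst (f z)) (Prod.fst (g z)), potMax τ (Prod.snd (f z)) (Prod.snd (g z)))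

/-- Componentwise maximum `χ ∨ χ'` of two complexities. -/
def cpxMax (σ : Ty) (χ χ' : ℕ × potDen σ) : ℕ × potDen σ :=
  (max χ.1 χ'.1, potMax σ χ.2 χ'.2)

/-- The value bounding relation is upward closed under maximum of potentials. -/
theorem BVal.potMax_left {τ : Ty} {v : Val} {p : potDen τ} (h : BVal τ v p) (q : potDen τ) :
    BVal τ v (potMax τ p q) := by
  induction τ generalizing v with
  | int | bool | list =>
    cases v <;> simp only [BVal, potMax] at h ⊢
    exact Nat.le_trans h (Nat.le_max_left _ _)
  | arrow σ τ _ ih =>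
    cases v <;> simp only [BVal, potMax] at h ⊢
    intro z r hz v n hv
    obtain ⟨hn, hv⟩ := h z r hz v n hv
    exact ⟨le_max_of_le_left hn, ih hv _⟩

/-- **Upward closure of the bounding relation under maximum** (Lemma 1):
if `t ξ ⊑_τ χ`, then for all complexities `χ' ∈ ⟦⟦τ⟧⟧`, `t ξ ⊑_τ χ ∨ χ'`. -/
theorem bounding_max {τ : Ty} {t : Exp} {ξ : VEnv} {χ : ℕ × potDen τ}
    (h : BClos τ t ξ χ) : ∀ χ' : ℕ × potDen τ, BClos τ t ξ (cpxMax τ χ χ') := by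
  intro χ' v n hv
  obtain ⟨hn, hv⟩ := h v n hv
  exact ⟨le_max_of_le_left hn, hv.potMax_left χ'.2⟩
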